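/- Let (a_k)_{k≥0} and (Δ_k)_{k≥0} be sequences of nonnegative reals such that Δ_k → 0, there is a constant C > 0 with |a_{k+1} − a_k| ≤ C·Δ_k for all k, liminf_{k→∞} a_k = 0, and for every ε > 0 the sum Σ_{k : a_k ≥ ε} Δ_k is finite. Then a_k → 0 as k → ∞. -/

import Mathlib

open Filter

/-- A nonnegative sequence whose increments are controlled by a vanishing
step-size sequence, whose liminf is zero, and whose step sizes are summable over every
superlevel set, converges to zero. -/
theorem stmt_16
    (a Δ : ℕ → ℝ) (C : ℝ)
    (ha : ∀ k, 0 ≤ a k) (hΔnn : ∀ k, 0 ≤ Δ k)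
    (hΔ0 : Tendsto Δ atTop (nhds 0))
    (hC : 0 < C)
    (hlip : ∀ k, |a (k + 1) - a k| ≤ C * Δ k)
    (hliminf : liminf a atTop = 0)
    (hsum : ∀ ε > 0, Summable fun k : {k : ℕ // ε ≤ a k} => Δ k.1) :
    Tendsto a atTop (nhds 0) := by
  have key : ∀ ε > 0, ∀ᶠ m in atTop, a m ≤ 3 * ε := by
    intro ε hε
    set g : ℕ → ℝ := Set.indicator {k | ε ≤ a k} Δ with hg
    have hgs : Summable g := summable_subtype_iff_indicator.mp (hsum ε hε)
    have hg0 : ∀ k, 0 ≤ g k := fun k => Set.indicator_nonneg (fun k _ => hΔnn k) k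
    set S : ℕ → ℝ := fun n => ∑ j ∈ Finset.range n, g j with hS
    have hSsucc : ∀ n, S (n + 1) = S n + g n := fun n => Finset.sum_range_succ g n
    have hSmono : Monotone S := monotone_nat_of_le_succ fun n => by
      linarith [hSsucc n, hg0 n]
    have hSle : ∀ n, S n ≤ ∑' k, g k := fun n => hgs.sum_le_tsum _ fun k _ => hg0 k
    have hstep : ∀ k, ε ≤ a k → a (k + 1) ≤ a k + C * (S (k + 1) - S k) := by
      intro k hk
      have hgk : g k = Δ k := Set.indicator_of_mem (s := {k | ε ≤ a k}) hk Δ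
      rw [hSsucc, hgk]
      linarith [le_of_abs_le (hlip k)]
    have hfreq : ∃ᶠ n in atTop, a n < ε := by
      intro hev
      simp only [not_lt] at hev
      obtain ⟨n, hn⟩ := eventually_atTop.mp hev
      have hbd : ∀ m ≥ n, a m ≤ a n + C * (S m - S n) := by
        intro m hm
        induction m, hm using Nat.le_induction with
        | base => simp
        | succ m hm ih => linarith [hstep m (hn m hm)]
      have hbdd : IsBoundedUnder (· ≤ ·) atTop a :=
        isBoundedUnder_of_eventually_le (a := a n + C * (∑' k, g k - S n)) <|
          eventually_atTop.mpr ⟨n, fun m hm => (hbd m hm).trans (by gcongr; exact hSle m)⟩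
      have := le_liminf_of_le hbdd.isCoboundedUnder_ge hev
      linarith
    have hT : ∀ᶠ n in atTop, ∑' k, g k - ε / C < S n :=
      hgs.hasSum.tendsto_sum_nat.eventually_const_lt (sub_lt_self _ (div_pos hε hC))
    have hΔ : ∀ᶠ n in atTop, Δ n < ε / C := hΔ0.eventually_lt_const (div_pos hε hC)
    obtain ⟨N, hN⟩ := eventually_atTop.mp (hT.and hΔ)
    obtain ⟨n, hnN, hn⟩ := frequently_atTop.mp hfreq N
    have hCε : C * (ε / C) = ε := mul_div_cancel₀ ε hC.ne'
    have hbd : ∀ m ≥ n, a m ≤ 2 * ε + C * (S m - S n) := by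
      intro m hm
      induction m, hm using Nat.le_induction with
      | base => simp; linarith
      | succ m hm ih =>
        rcases le_or_gt ε (a m) with h | h
        · linarith [hstep m h]
        · have h1 := mul_le_mul_of_nonneg_left (hN m (hnN.trans hm)).2.le hC.le
          have h2 : 0 ≤ C * (S (m + 1) - S n) :=
            mul_nonneg hC.le (sub_nonneg.mpr (hSmono (by omega)))
          linarith [le_of_abs_le (hlip m)]
    refine eventually_atTop.mpr ⟨n, fun m hm => ?_⟩
    have h1 : C * (S m - S n) ≤ C * (ε / C) :=
      mul_le_mul_of_nonneg_left (by linarith [hSle m, (hN n hnN).1]) hC.le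
    linarith [hbd m hm]
  refine tendsto_order.mpr ⟨fun b hb => .of_forall fun k => hb.trans_le (ha k), fun b hb => ?_⟩
  filter_upwards [key (b / 4) (by positivity)] with m hm
  linarith
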